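/- arXiv:1406.2834 — 2 statements merged into one kernel-verified Lean document; each statement's English description precedes it below -/
import Mathlib

section
/- Theorem 1, parts (a) and (b) (single-letterization of the K-user common-message broadcast problem with |U| ≤ K): Let X, Y be nonempty finite sets, K ≥ 1, and let B₁,…,B_K be real matrices indexed by Y × X such that each B_i is a contraction (∑_y ((B_iψ)(y))² ≤ ∑_x ψ(x)² for every ψ : X → ℝ) and B_iᵀ·(B_i·v₀) = v₀ for a fixed unit vector v₀ : X → ℝ (∑_x v₀(x)² = 1). Then for every n ≥ 1, every nonempty finite type U, every probability distribution p on U, and every family ψ : U → ((Fin n → X) → ℝ) satisfying ∑_u p(u)·‖ψ_u‖² = 1 and ⟨ψ_u, v₀^(n)⟩ = 0 for every u, there exists a family w : Fin K → (X → ℝ) with ∑_{u∈Fin K} ‖w_u‖² = 1 and ⟨w_u, v₀⟩ = 0 for every u, such that min_{1≤i≤K} ∑_{u∈U} p(u)·‖B_i^(n)·ψ_u‖² ≤ min_{1≤i≤K} ∑_{u∈Fin K} ‖B_i·w_u‖². In particular, the n-letter optimum λ^(n) of the problem max min_i ∑_u P_U(u)·‖B_i^(n)ψ_u‖² subject to ∑_u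 P_U(u)·‖ψ_u‖² = 1 and ⟨ψ_u, v₀^(n)⟩ = 0 equals the single-letter optimum λ^(1), attained with an auxiliary alphabet U of cardinality at most K and uniform P_U. -/
/-- The `n`-th Kronecker power of a matrix. -/
def kroneckerPow {X Y : Type*} (n : ℕ) (A : Matrix Y X ℝ) :
    Matrix (Fin n → Y) (Fin n → X) ℝ :=
  Matrix.of fun r c => ∏ j, A (r j) (c j)

theorem Fin.sum_pi_cons {X M : Type*} [Fintype X] [AddCommMonoid M] {n : ℕ}
    (f : (Fin (n + 1) → X) → M) :
    ∑ c, f c = ∑ x, ∑ c : Fin n → X, f (Fin.cons x c) := by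
  rw [← Fintype.sum_prod_type']
  exact (Fintype.sum_equiv (Fin.consEquiv fun _ => X) _ _ fun _ => rfl).symm

section Matrix

open Matrix

theorem Matrix.mulVec_mulVec_apply_comm {X Y I J : Type*} [Fintype X] [Fintype J]
    (A : Matrix Y X ℝ) (M : Matrix I J ℝ) (Ψ : X → J → ℝ) (y : Y) (r : I) :
    (A *ᵥ fun x => (M *ᵥ Ψ x) r) y = (M *ᵥ fun c => (A *ᵥ fun x => Ψ x c) y) r := by
  simp only [mulVec, dotProduct, Finset.mul_sum]
  rw [Finset.sum_comm]
  exact Finset.sum_congr rfl fun _ _ => Finset.sum_congr rfl fun _ _ => by ring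

variable {X Y : Type*} [Fintype X]

theorem kroneckerPow_succ_mulVec_cons {n : ℕ} (A : Matrix Y X ℝ)
    (ψ : (Fin (n + 1) → X) → ℝ) (y : Y) (r : Fin n → Y) :
    (kroneckerPow (n + 1) A *ᵥ ψ) (Fin.cons y r) =
      (A *ᵥ fun x => (kroneckerPow n A *ᵥ fun c => ψ (Fin.cons x c)) r) y := by
  simp only [mulVec, dotProduct, kroneckerPow, Fin.sum_pi_cons, Matrix.of_apply,
    Fin.prod_univ_succ, Fin.cons_zero, Fin.cons_succ, Finset.mul_sum, mul_assoc]

variable [Fintype Y]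

theorem kroneckerPow_succ_energy {n : ℕ} (A : Matrix Y X ℝ) (ψ : (Fin (n + 1) → X) → ℝ) :
    (kroneckerPow (n + 1) A *ᵥ ψ) ⬝ᵥ (kroneckerPow (n + 1) A *ᵥ ψ) =
      ∑ r : Fin n → Y,
        (A *ᵥ fun x => (kroneckerPow n A *ᵥ fun c => ψ (Fin.cons x c)) r) ⬝ᵥ
          (A *ᵥ fun x => (kroneckerPow n A *ᵥ fun c => ψ (Fin.cons x c)) r) := by
  rw [dotProduct, Fin.sum_pi_cons, Finset.sum_comm]
  simp only [kroneckerPow_succ_mulVec_cons, dotProduct]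

theorem kroneckerPow_energy_le {A : Matrix Y X ℝ}
    (hA : ∀ v : X → ℝ, (A *ᵥ v) ⬝ᵥ (A *ᵥ v) ≤ v ⬝ᵥ v) :
    ∀ (n : ℕ) (ψ : (Fin n → X) → ℝ),
      (kroneckerPow n A *ᵥ ψ) ⬝ᵥ (kroneckerPow n A *ᵥ ψ) ≤ ψ ⬝ᵥ ψ
  | 0, ψ => by simp [kroneckerPow, mulVec, dotProduct]
  | n + 1, ψ => by
    rw [kroneckerPow_succ_energy]
    refine (Finset.sum_le_sum fun r _ => hA _).trans ?_
    simp only [dotProduct]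
    rw [Finset.sum_comm, Fin.sum_pi_cons]
    exact Finset.sum_le_sum fun x _ =>
      kroneckerPow_energy_le hA n fun c => ψ (Fin.cons x c)

theorem Matrix.energy_add_smul_fixed {A : Matrix Y X ℝ} {v₀ : X → ℝ}
    (hunit : v₀ ⬝ᵥ v₀ = 1) (hfix : Aᵀ *ᵥ (A *ᵥ v₀) = v₀)
    (a : ℝ) {g : X → ℝ} (hg : g ⬝ᵥ v₀ = 0) :
    (A *ᵥ (a • v₀ + g)) ⬝ᵥ (A *ᵥ (a • v₀ + g)) = a * a + (A *ᵥ g) ⬝ᵥ (A *ᵥ g) := by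
  have key (h : X → ℝ) : (A *ᵥ h) ⬝ᵥ (A *ᵥ v₀) = h ⬝ᵥ v₀ := by
    rw [dotProduct_comm, dotProduct_mulVec, ← mulVec_transpose, hfix, dotProduct_comm]
  simp only [mulVec_add, mulVec_smul, add_dotProduct, dotProduct_add, smul_dotProduct,
    dotProduct_smul, key, dotProduct_comm (A *ᵥ v₀) (A *ᵥ g), hunit, hg, smul_eq_mul]
  ring

/-- Splitting off the `v₀`-component in the first coordinate, an `(n + 1)`-letter output energy
is at most the `n`-letter output energy of that component plus the single-letter output energies
of the slices of the remainder. -/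
theorem kroneckerPow_succ_energy_le {n : ℕ} {A : Matrix Y X ℝ} {v₀ : X → ℝ}
    (hA : ∀ v : X → ℝ, (A *ᵥ v) ⬝ᵥ (A *ᵥ v) ≤ v ⬝ᵥ v)
    (hunit : v₀ ⬝ᵥ v₀ = 1) (hfix : Aᵀ *ᵥ (A *ᵥ v₀) = v₀)
    (φ : (Fin n → X) → ℝ) (χ : X → (Fin n → X) → ℝ) (hχ : ∀ c, (fun x => χ x c) ⬝ᵥ v₀ = 0)
    {ψ : (Fin (n + 1) → X) → ℝ} (hψ : ∀ x c, ψ (Fin.cons x c) = v₀ x * φ c + χ x c) :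
    (kroneckerPow (n + 1) A *ᵥ ψ) ⬝ᵥ (kroneckerPow (n + 1) A *ᵥ ψ) ≤
      (kroneckerPow n A *ᵥ φ) ⬝ᵥ (kroneckerPow n A *ᵥ φ) +
        ∑ c, (A *ᵥ fun x => χ x c) ⬝ᵥ (A *ᵥ fun x => χ x c) := by
  have hsplit (r : Fin n → Y) :
      (fun x => (kroneckerPow n A *ᵥ fun c => ψ (Fin.cons x c)) r) =
        (kroneckerPow n A *ᵥ φ) r • v₀ + fun x => (kroneckerPow n A *ᵥ χ x) r := by
    funext x
    have : (fun c => ψ (Fin.cons x c)) = v₀ x • φ + χ x := funext fun c => hψ x c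
    rw [this, mulVec_add, mulVec_smul]
    simp [mul_comm]
  have horth (r : Fin n → Y) : (fun x => (kroneckerPow n A *ᵥ χ x) r) ⬝ᵥ v₀ = 0 := by
    have h := mulVec_mulVec_apply_comm (replicateRow Unit v₀) (kroneckerPow n A) χ () r
    simp only [mulVec, replicateRow_apply] at h
    rw [dotProduct_comm]
    refine h.trans ?_
    simp only [dotProduct] at hχ ⊢
    simp [mul_comm (v₀ _), hχ]
  rw [kroneckerPow_succ_energy]
  simp only [hsplit, energy_add_smul_fixed hunit hfix _ (horth _), Finset.sum_add_distrib]
  refine add_le_add le_rfl ?_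
  simp only [mulVec_mulVec_apply_comm A, dotProduct]
  rw [Finset.sum_comm, Finset.sum_comm (s := Finset.univ (α := Fin n → X))]
  exact Finset.sum_le_sum fun y _ =>
    kroneckerPow_energy_le hA n fun c => (A *ᵥ fun x => χ x c) y

end Matrix

/-- A conic Carathéodory reduction: a nonnegative combination can be re-weighted so as to be
supported on at most `K` indices, preserving the total of the positive function `N` and not
decreasing any of the `K` coordinates of the combination. -/
theorem exists_reweighting_card_le {ι : Type*} {K : ℕ} (i₀ : Fin K) (N : ι → ℝ)
    (q : ι → Fin K → ℝ) (s : Finset ι) (hN : ∀ k ∈ s, 0 < N k) (t : ι → ℝ)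
    (ht : ∀ k ∈ s, 0 ≤ t k) :
    ∃ s' ⊆ s, s'.card ≤ K ∧ ∃ t' : ι → ℝ, (∀ k ∈ s', 0 ≤ t' k) ∧
      ∑ k ∈ s', t' k * N k = ∑ k ∈ s, t k * N k ∧
      ∀ i, ∑ k ∈ s, t k * q k i ≤ ∑ k ∈ s', t' k * q k i := by
  classical
  induction s using Finset.strongInduction generalizing t with
  | H s ih =>
  by_cases hcard : s.card ≤ K
  · exact ⟨s, subset_rfl, hcard, t, ht, rfl, fun _ => le_rfl⟩
  obtain ⟨d, ⟨k₁, hk₁, hdk₁⟩, hdN, c, hc, hdq⟩ : ∃ d : ι → ℝ, (∃ k ∈ s, d k ≠ 0) ∧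
      ∑ k ∈ s, d k * N k = 0 ∧ ∃ c : ℝ, 0 ≤ c ∧ ∀ i, ∑ k ∈ s, d k * q k i = c := by
    have hdep : ¬ LinearIndepOn ℝ
        (fun k i => if i = i₀ then N k else q k i - q k i₀ : ι → Fin K → ℝ) (s : Set ι) := by
      intro h
      have := LinearIndependent.fintype_card_le_finrank h
      simp at this
      omega
    obtain ⟨d, hd, hne⟩ := not_linearIndepOn_finset_iff.1 hdep
    have hdN : ∑ k ∈ s, d k * N k = 0 := by simpa using congrFun hd i₀
    have hdq (i : Fin K) : ∑ k ∈ s, d k * q k i = ∑ k ∈ s, d k * q k i₀ := by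
      rcases eq_or_ne i i₀ with rfl | hi
      · rfl
      · have := congrFun hd i
        simpa [hi, mul_sub, sub_eq_zero] using this
    rcases le_total 0 (∑ k ∈ s, d k * q k i₀) with h | h
    · exact ⟨d, hne, hdN, _, h, hdq⟩
    · refine ⟨fun k => -d k, by simpa using hne, by simpa using hdN,
        -∑ k ∈ s, d k * q k i₀, by linarith, fun i => ?_⟩
      simpa using hdq i
  have hneg : (s.filter fun k => d k < 0).Nonempty := by
    by_contra! hempty
    have hd0 : ∀ k ∈ s, 0 ≤ d k := fun k hk => by
      by_contra! hlt
      exact (hempty ▸ Finset.notMem_empty k) (Finset.mem_filter.2 ⟨hk, hlt⟩)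
    have := (Finset.sum_eq_zero_iff_of_nonneg fun k hk =>
      mul_nonneg (hd0 k hk) (hN k hk).le).1 hdN k₁ hk₁
    exact (mul_ne_zero hdk₁ (hN k₁ hk₁).ne') this
  obtain ⟨k₀, hk₀, hmin⟩ := Finset.exists_min_image _ (fun k => t k / -d k) hneg
  obtain ⟨hk₀s, hdk₀⟩ := Finset.mem_filter.1 hk₀
  set τ := t k₀ / -d k₀ with hτ
  have hτ0 : 0 ≤ τ := div_nonneg (ht k₀ hk₀s) (by linarith)
  have hzero : t k₀ + τ * d k₀ = 0 := by
    rw [hτ]; field_simp [hdk₀.ne]; ring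
  have hnonneg : ∀ k ∈ s, 0 ≤ t k + τ * d k := fun k hk => by
    rcases lt_or_ge (d k) 0 with hlt | hge
    · have := hmin k (Finset.mem_filter.2 ⟨hk, hlt⟩)
      rw [le_div_iff₀ (by linarith)] at this
      linarith
    · exact add_nonneg (ht k hk) (mul_nonneg hτ0 hge)
  have hsum (f : ι → ℝ) : ∑ k ∈ s.erase k₀, (t k + τ * d k) * f k =
      ∑ k ∈ s, t k * f k + τ * ∑ k ∈ s, d k * f k := by
    rw [Finset.sum_erase _ (by simp [hzero]), Finset.mul_sum, ← Finset.sum_add_distrib]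
    exact Finset.sum_congr rfl fun _ _ => by ring
  obtain ⟨s', hs', hcard', t', ht', hN', hq'⟩ := ih (s.erase k₀) (Finset.erase_ssubset hk₀s)
    (fun k hk => hN k (Finset.mem_of_mem_erase hk)) (fun k => t k + τ * d k)
    fun k hk => hnonneg k (Finset.mem_of_mem_erase hk)
  refine ⟨s', hs'.trans (Finset.erase_subset _ _), hcard', t', ht', ?_, fun i => ?_⟩
  · rw [hN', hsum, hdN, mul_zero, add_zero]
  · refine le_trans ?_ (hq' i)
    rw [hsum fun k => q k i, hdq]
    exact le_add_of_nonneg_right (mul_nonneg hτ0 hc)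

section Single

open Matrix

variable {X Y : Type*} [Fintype X] [Fintype Y] {K : ℕ}

/-- Every finite family of vectors orthogonal to `v₀` can be replaced by `K` such vectors with the
same total energy, without decreasing any of the `K` output energies. -/
theorem exists_family_of_fintype {ι : Type*} [Fintype ι] (i₀ : Fin K) (B : Fin K → Matrix Y X ℝ)
    (v₀ : X → ℝ) (f : ι → X → ℝ) (hf : ∀ k, f k ⬝ᵥ v₀ = 0) :
    ∃ w : Fin K → X → ℝ, (∀ u, w u ⬝ᵥ v₀ = 0) ∧
      ∑ u, w u ⬝ᵥ w u = ∑ k, f k ⬝ᵥ f k ∧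
      ∀ i, ∑ k, (B i *ᵥ f k) ⬝ᵥ (B i *ᵥ f k) ≤ ∑ u, (B i *ᵥ w u) ⬝ᵥ (B i *ᵥ w u) := by
  classical
  obtain ⟨s, -, hcard, t, ht, hN, hq⟩ := exists_reweighting_card_le i₀
    (fun k => f k ⬝ᵥ f k) (fun k i => (B i *ᵥ f k) ⬝ᵥ (B i *ᵥ f k))
    (Finset.univ.filter fun k => f k ≠ 0)
    (fun k hk => by
      rw [lt_iff_le_and_ne]
      exact ⟨Finset.sum_nonneg fun x _ => mul_self_nonneg _,
        fun h => (Finset.mem_filter.1 hk).2 (dotProduct_self_eq_zero.1 h.symm)⟩)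
    (fun _ => 1) (fun _ _ => zero_le_one)
  have hfilter (F : (X → ℝ) → ℝ) (hF : F 0 = 0) :
      ∑ k ∈ Finset.univ.filter (fun k => f k ≠ 0), 1 * F (f k) = ∑ k, F (f k) := by
    simp only [one_mul]
    exact Finset.sum_filter_of_ne fun k _ hk h0 => hk (by rw [h0, hF])
  obtain ⟨e⟩ : Nonempty (s ↪ Fin K) :=
    Function.Embedding.nonempty_of_card_le (by simpa using hcard)
  set w : Fin K → X → ℝ :=
    Function.extend e (fun k : s => √(t k) • f k) 0 with hw
  have hwe (k : s) : w (e k) = √(t k) • f k := e.injective.extend_apply _ _ _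
  have hw0 (u : Fin K) (hu : u ∉ Set.range e) : w u = 0 :=
    Function.extend_apply' _ _ _ hu
  have hsum (F : (X → ℝ) → ℝ) (hF : F 0 = 0) (hsmul : ∀ (a : ℝ) v, F (a • v) = a * a * F v) :
      ∑ u, F (w u) = ∑ k ∈ s, t k * F (f k) := by
    rw [← Finset.sum_coe_sort s]
    refine (Fintype.sum_of_injective e e.injective _ _ (fun u hu => ?_) fun k => ?_).symm
    · rw [hw0 u hu, hF]
    · rw [hwe, hsmul, Real.mul_self_sqrt (ht k k.2)]
  refine ⟨w, fun u => ?_, ?_, fun i => ?_⟩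
  · by_cases hu : u ∈ Set.range e
    · obtain ⟨k, rfl⟩ := hu
      rw [hwe, smul_dotProduct, hf, smul_zero]
    · rw [hw0 u hu, zero_dotProduct]
  · rw [hsum (fun v => v ⬝ᵥ v) (by simp) (fun a v => by simp [mul_assoc]), hN,
      hfilter (fun v => v ⬝ᵥ v) (by simp)]
  · rw [hsum (fun v => (B i *ᵥ v) ⬝ᵥ (B i *ᵥ v)) (by simp)
      (fun a v => by simp [mulVec_smul, mul_assoc]),
      ← hfilter (fun v => (B i *ᵥ v) ⬝ᵥ (B i *ᵥ v)) (by simp)]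
    exact hq i

/-- The pairs `(N, a)` such that some `K` vectors orthogonal to `v₀` have total energy `N` and
output energies at least `a`. -/
def achievable (i₀ : Fin K) (B : Fin K → Matrix Y X ℝ) (v₀ : X → ℝ) :
    AddSubmonoid (ℝ × (Fin K → ℝ)) where
  carrier := {z | ∃ w : Fin K → X → ℝ, (∀ u, w u ⬝ᵥ v₀ = 0) ∧ ∑ u, w u ⬝ᵥ w u = z.1 ∧
    ∀ i, z.2 i ≤ ∑ u, (B i *ᵥ w u) ⬝ᵥ (B i *ᵥ w u)}
  zero_mem' := ⟨0, by simp, by simp, by simp⟩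
  add_mem' := by
    rintro z z' ⟨w, hw, hN, hq⟩ ⟨w', hw', hN', hq'⟩
    obtain ⟨v, hv, hvN, hvq⟩ := exists_family_of_fintype i₀ B v₀ (Sum.elim w w')
      (by rintro (k | k) <;> simp [hw, hw'])
    simp only [Fintype.sum_sum_type, Sum.elim_inl, Sum.elim_inr] at hvN hvq
    exact ⟨v, hv, by rw [hvN, hN, hN', Prod.fst_add],
      fun i => (add_le_add (hq i) (hq' i)).trans (hvq i)⟩

variable {i₀ : Fin K} {B : Fin K → Matrix Y X ℝ} {v₀ : X → ℝ}

theorem achievable_of_le {N : ℝ} {a b : Fin K → ℝ} (h : (N, b) ∈ achievable i₀ B v₀)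
    (hab : a ≤ b) : (N, a) ∈ achievable i₀ B v₀ := by
  obtain ⟨w, hw, hN, hq⟩ := h
  exact ⟨w, hw, hN, fun i => (hab i).trans (hq i)⟩

theorem achievable_single {v : X → ℝ} (hv : v ⬝ᵥ v₀ = 0) :
    (v ⬝ᵥ v, fun i => (B i *ᵥ v) ⬝ᵥ (B i *ᵥ v)) ∈ achievable i₀ B v₀ := by
  obtain ⟨w, hw, hN, hq⟩ := exists_family_of_fintype i₀ B v₀ (fun _ : Unit => v) fun _ => hv
  exact ⟨w, hw, by simpa using hN, by simpa using hq⟩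

theorem achievable_smul {z : ℝ × (Fin K → ℝ)} (hz : z ∈ achievable i₀ B v₀) {a : ℝ}
    (ha : 0 ≤ a) : a • z ∈ achievable i₀ B v₀ := by
  obtain ⟨w, hw, hN, hq⟩ := hz
  have hsq (x : ℝ) : √a * (√a * x) = a * x := by rw [← mul_assoc, Real.mul_self_sqrt ha]
  refine ⟨fun u => √a • w u, fun u => by rw [smul_dotProduct, hw, smul_zero], ?_, fun i => ?_⟩
  · simp [hsq, ← Finset.mul_sum, hN]
  · simpa [mulVec_smul, hsq, ← Finset.mul_sum] using mul_le_mul_of_nonneg_left (hq i) ha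

theorem achievable_kroneckerPow
    (hB : ∀ i, ∀ v : X → ℝ, (B i *ᵥ v) ⬝ᵥ (B i *ᵥ v) ≤ v ⬝ᵥ v)
    (hunit : v₀ ⬝ᵥ v₀ = 1) (hfix : ∀ i, (B i)ᵀ *ᵥ (B i *ᵥ v₀) = v₀) :
    ∀ (n : ℕ) (ψ : (Fin n → X) → ℝ), (ψ ⬝ᵥ fun c => ∏ j, v₀ (c j)) = 0 →
      (ψ ⬝ᵥ ψ, fun i => (kroneckerPow n (B i) *ᵥ ψ) ⬝ᵥ (kroneckerPow n (B i) *ᵥ ψ)) ∈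
        achievable i₀ B v₀
  | 0, ψ, hψ => by
    obtain rfl : ψ = 0 := by
      funext c
      simpa [dotProduct, Subsingleton.elim default c] using hψ
    simp only [mulVec_zero, dotProduct_zero]
    exact (achievable i₀ B v₀).zero_mem
  | n + 1, ψ, hψ => by
    set φ : (Fin n → X) → ℝ := fun c => v₀ ⬝ᵥ fun x => ψ (Fin.cons x c) with hφ
    set χ : X → (Fin n → X) → ℝ := fun x c => ψ (Fin.cons x c) - v₀ x * φ c with hχ
    have hdecomp (x : X) (c : Fin n → X) : ψ (Fin.cons x c) = v₀ x * φ c + χ x c := by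
      simp [hχ]
    have hχorth (c : Fin n → X) : (fun x => χ x c) ⬝ᵥ v₀ = 0 := by
      have : (fun x => χ x c) = (fun x => ψ (Fin.cons x c)) - φ c • v₀ := by
        funext x; simp [hχ, mul_comm]
      rw [this, sub_dotProduct, smul_dotProduct, hunit, dotProduct_comm]
      simp [hφ]
    have hφorth : (φ ⬝ᵥ fun c => ∏ j, v₀ (c j)) = 0 := by
      rw [← hψ]
      simp only [dotProduct, Fin.sum_pi_cons, hφ, Fin.prod_univ_succ, Fin.cons_zero,
        Fin.cons_succ, Finset.sum_mul]
      rw [Finset.sum_comm]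
      exact Finset.sum_congr rfl fun _ _ => Finset.sum_congr rfl fun _ _ => by ring
    have hnorm : ψ ⬝ᵥ ψ = φ ⬝ᵥ φ + ∑ c, (fun x => χ x c) ⬝ᵥ fun x => χ x c := by
      classical
      have (c : Fin n → X) : ∑ x, ψ (Fin.cons x c) * ψ (Fin.cons x c) =
          φ c * φ c + (fun x => χ x c) ⬝ᵥ fun x => χ x c := by
        have h := energy_add_smul_fixed (A := (1 : Matrix X X ℝ)) hunit (by simp) (φ c)
          (hχorth c)
        simp only [one_mulVec] at h
        rw [← h]
        simp [dotProduct, hdecomp, mul_comm]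
      rw [dotProduct, Fin.sum_pi_cons, Finset.sum_comm]
      simp only [this, Finset.sum_add_distrib]
      rfl
    have hmem := (achievable i₀ B v₀).add_mem
      (achievable_kroneckerPow hB hunit hfix n φ hφorth)
      ((achievable i₀ B v₀).sum_mem fun c (_ : c ∈ Finset.univ) =>
        achievable_single (hχorth c))
    rw [hnorm]
    refine achievable_of_le (b := (fun i => (kroneckerPow n (B i) *ᵥ φ) ⬝ᵥ
      (kroneckerPow n (B i) *ᵥ φ)) +
        ∑ c, fun i => (B i *ᵥ fun x => χ x c) ⬝ᵥ (B i *ᵥ fun x => χ x c)) ?_ fun i => ?_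
    · convert hmem using 1
      ext <;> simp [Prod.fst_sum, Prod.snd_sum]
    · simpa using kroneckerPow_succ_energy_le (hB i) hunit (hfix i) φ χ hχorth hdecomp

end Single

/-- Theorem 1, parts (a) and (b): single-letterization of the K-user
common-message broadcast problem with auxiliary cardinality at most `K`.
If each `B_i` is a contraction fixing the unit vector `v₀`, then any feasible
`n`-letter family `(P_U, ψ_u)` is outperformed by a single-letter family of `K`
vectors `w_u` (orthogonal to `v₀`, with total squared norm `1`), in the sense
that the minimum over the `K` users of the average output energy does not
decrease. -/
theorem broadcast_common_message_single_letterization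
    {X Y U : Type*} [Fintype X] [Fintype Y] [Fintype U]
    [Nonempty X] [Nonempty Y] [Nonempty U]
    (K : ℕ) (hK : 1 ≤ K) (B : Fin K → Matrix Y X ℝ)
    (hcontr : ∀ i, ∀ ψ : X → ℝ, ∑ y, ((B i).mulVec ψ y) ^ 2 ≤ ∑ x, ψ x ^ 2)
    (v₀ : X → ℝ) (hv₀ : ∑ x, v₀ x ^ 2 = 1)
    (hfix : ∀ i, (B i).transpose.mulVec ((B i).mulVec v₀) = v₀)
    (n : ℕ) (hn : 1 ≤ n)
    (p : U → ℝ) (hp0 : ∀ u, 0 ≤ p u) (hp1 : ∑ u, p u = 1)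
    (ψ : U → (Fin n → X) → ℝ)
    (hnorm : ∑ u, p u * ∑ c : Fin n → X, ψ u c ^ 2 = 1)
    (horth : ∀ u, ∑ c : Fin n → X, ψ u c * ∏ j, v₀ (c j) = 0) :
    ∃ w : Fin K → X → ℝ,
      (∑ u, ∑ x, w u x ^ 2 = 1) ∧
      (∀ u, ∑ x, w u x * v₀ x = 0) ∧
      (Finset.univ.inf' ⟨⟨0, hK⟩, Finset.mem_univ _⟩
          fun i : Fin K => ∑ u, p u * ∑ r : Fin n → Y,
            ((Matrix.of fun (r : Fin n → Y) (c : Fin n → X) =>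
                ∏ j, B i (r j) (c j)).mulVec (ψ u) r) ^ 2)
        ≤ Finset.univ.inf' ⟨⟨0, hK⟩, Finset.mem_univ _⟩
          fun i : Fin K => ∑ u, ∑ y, ((B i).mulVec (w u) y) ^ 2 := by
  have hmem := (achievable ⟨0, hK⟩ B v₀).sum_mem fun u (_ : u ∈ Finset.univ) =>
    achievable_smul (achievable_kroneckerPow (i₀ := ⟨0, hK⟩)
      (fun i v => by simpa only [dotProduct, sq] using hcontr i v)
      (by simpa only [dotProduct, sq] using hv₀) hfix n (ψ u) (horth u)) (hp0 u)
  obtain ⟨w, hw, hN, hq⟩ := hmem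
  refine ⟨w, ?_, hw, Finset.le_inf' _ _ fun i hi => (Finset.inf'_le _ hi).trans ?_⟩
  · rw [← hnorm]
    simpa [Prod.fst_sum, dotProduct, sq] using hN
  · simpa [Prod.snd_sum, dotProduct, sq, kroneckerPow] using hq i
end

section
/- Theorem 1, part (c), general K (K letters suffice): Let X, Y be nonempty finite sets, K ≥ 1, and let B₁,…,B_K be real matrices indexed by Y × X such that each B_i is a contraction (∑_y ((B_iψ)(y))² ≤ ∑_x ψ(x)² for every ψ : X → ℝ) and B_iᵀ·(B_i·v₀) = v₀ for a fixed unit vector v₀ : X → ℝ. Then for every n ≥ 1 and every ψ : (Fin n → X) → ℝ with ‖ψ‖ = 1 and ⟨ψ, v₀^(n)⟩ = 0, there exists φ : (Fin K → X) → ℝ with ‖φ‖ = 1 and ⟨φ, v₀^(K)⟩ = 0 such that min_{1≤i≤K} ‖B_i^(n)·ψ‖² ≤ min_{1≤i≤K} ‖B_i^(K)·φ‖². In other words, sup_n λ_B^(n) = λ_B^(K), where λ_B^(n) is the optimum of the single-direction (binary equiprobable U) n-letter problem. -/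
universe u

/-- The `n`-th Kronecker power of a matrix, indexed by words of length `n`. -/
def kronPow {X Y : Type*} (B : Matrix Y X ℝ) (n : ℕ) : Matrix (Fin n → Y) (Fin n → X) ℝ :=
  Matrix.of fun r c => ∏ j, B (r j) (c j)

theorem sum_fin_succ_pi {X : Type*} [Fintype X] (n : ℕ) (f : (Fin (n + 1) → X) → ℝ) :
    ∑ c, f c = ∑ c : Fin n → X, ∑ x, f (Fin.cons x c) := by
  rw [← (Fin.consEquiv fun _ : Fin (n + 1) => X).sum_comp, Fintype.sum_prod_type_right]
  rfl

theorem mulVec_sum_mul {X Y Z : Type*} [Fintype X] [Fintype Z] (B : Matrix Y X ℝ)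
    (a : Z → ℝ) (f : Z → X → ℝ) (y : Y) :
    B.mulVec (fun x => ∑ z, a z * f z x) y = ∑ z, a z * B.mulVec (f z) y := by
  simp only [Matrix.mulVec, dotProduct, Finset.mul_sum]
  rw [Finset.sum_comm]
  exact Finset.sum_congr rfl fun z _ => Finset.sum_congr rfl fun x _ => by ring

theorem kronPow_succ_mulVec {X Y : Type*} [Fintype X] (B : Matrix Y X ℝ) (n : ℕ)
    (ψ : (Fin (n + 1) → X) → ℝ) (y : Y) (r : Fin n → Y) :
    (kronPow B (n + 1)).mulVec ψ (Fin.cons y r) =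
      B.mulVec (fun x => (kronPow B n).mulVec (fun c => ψ (Fin.cons x c)) r) y := by
  simp only [Matrix.mulVec, dotProduct, kronPow, Matrix.of_apply, Finset.mul_sum]
  rw [sum_fin_succ_pi, Finset.sum_comm]
  refine Finset.sum_congr rfl fun x _ => Finset.sum_congr rfl fun c _ => ?_
  simp only [Fin.prod_univ_succ, Fin.cons_zero, Fin.cons_succ]
  ring

theorem mulVec_mulVec_comm {X Y Z W : Type*} [Fintype X] [Fintype Z] (A : Matrix Y X ℝ)
    (B : Matrix W Z ℝ) (f : X → Z → ℝ) (y : Y) (w : W) :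
    A.mulVec (fun x => B.mulVec (f x) w) y = B.mulVec (fun z => A.mulVec (fun x => f x z) y) w := by
  simp only [Matrix.mulVec, dotProduct, Finset.mul_sum]
  rw [Finset.sum_comm]
  exact Finset.sum_congr rfl fun z _ => Finset.sum_congr rfl fun x _ => by ring

theorem sum_kronPow_mulVec_sq_le {X Y : Type*} [Fintype X] [Fintype Y] {B : Matrix Y X ℝ}
    (hB : ∀ ψ : X → ℝ, ∑ y, B.mulVec ψ y ^ 2 ≤ ∑ x, ψ x ^ 2) (n : ℕ) (ψ : (Fin n → X) → ℝ) :
    ∑ r, (kronPow B n).mulVec ψ r ^ 2 ≤ ∑ c, ψ c ^ 2 := by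
  induction n with
  | zero => simp [kronPow, Matrix.mulVec, dotProduct]
  | succ n ih =>
    rw [sum_fin_succ_pi, sum_fin_succ_pi]
    simp only [kronPow_succ_mulVec]
    calc _ ≤ ∑ r : Fin n → Y, ∑ x, (kronPow B n).mulVec (fun c => ψ (Fin.cons x c)) r ^ 2 :=
          Finset.sum_le_sum fun r _ => hB _
      _ = ∑ x, ∑ r : Fin n → Y, (kronPow B n).mulVec (fun c => ψ (Fin.cons x c)) r ^ 2 :=
          Finset.sum_comm
      _ ≤ ∑ x, ∑ c : Fin n → X, ψ (Fin.cons x c) ^ 2 := Finset.sum_le_sum fun x _ => ih _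
      _ = _ := Finset.sum_comm

theorem sum_mulVec_mul_mulVec {X Y : Type*} [Fintype X] [Fintype Y] {B : Matrix Y X ℝ}
    {v : X → ℝ} (hfix : B.transpose.mulVec (B.mulVec v) = v) (f : X → ℝ) :
    ∑ y, B.mulVec f y * B.mulVec v y = ∑ x, f x * v x := by
  change B.mulVec f ⬝ᵥ B.mulVec v = f ⬝ᵥ v
  rw [← Matrix.vecMul_transpose, ← Matrix.dotProduct_mulVec, hfix]

/-- Pythagoras for the image of a vector split along a fixed unit vector of `Bᵀ B`. -/
theorem sum_mulVec_sq_eq_add {X Y : Type*} [Fintype X] [Fintype Y] {B : Matrix Y X ℝ}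
    {v : X → ℝ} (hv : ∑ x, v x ^ 2 = 1) (hfix : B.transpose.mulVec (B.mulVec v) = v)
    (f : X → ℝ) :
    ∑ y, B.mulVec f y ^ 2 = (∑ x, f x * v x) ^ 2 +
      ∑ y, B.mulVec (fun x => f x - (∑ x', f x' * v x') * v x) y ^ 2 := by
  set a := ∑ x, f x * v x with ha
  have h1 := sum_mulVec_mul_mulVec hfix f
  have h2 := sum_mulVec_mul_mulVec hfix v
  have h3 : ∑ x, v x * v x = 1 := by simpa only [sq] using hv
  have h4 : B.mulVec (fun x => f x - a * v x) = fun y => B.mulVec f y - a * B.mulVec v y := by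
    have : (fun x => f x - a * v x) = f - a • v := by ext x; simp
    rw [this, Matrix.mulVec_sub, Matrix.mulVec_smul]
    ext y; simp
  have h5 : ∑ y, (B.mulVec f y - a * B.mulVec v y) ^ 2 = ∑ y, B.mulVec f y ^ 2
      - 2 * a * ∑ y, B.mulVec f y * B.mulVec v y + a ^ 2 * ∑ y, B.mulVec v y * B.mulVec v y := by
    simp only [Finset.mul_sum, ← Finset.sum_sub_distrib, ← Finset.sum_add_distrib]
    exact Finset.sum_congr rfl fun y _ => by ring
  rw [h4, h5, h1, h2, h3, ← ha]
  ring

theorem sum_sq_eq_add {X : Type*} [Fintype X] {v : X → ℝ} (hv : ∑ x, v x ^ 2 = 1) (f : X → ℝ) :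
    ∑ x, f x ^ 2 = (∑ x, f x * v x) ^ 2 + ∑ x, (f x - (∑ x', f x' * v x') * v x) ^ 2 := by
  classical
  simpa using sum_mulVec_sq_eq_add (B := (1 : Matrix X X ℝ)) hv (by simp) f

/-- The quadratic values of a vector orthogonal to `v₀^(n)` are dominated, simultaneously for all
the contractions, by those of a mixture of one-letter vectors orthogonal to `v₀`. -/
theorem exists_one_letter_mixture {ι : Type*} {X : Type u} {Y : Type*} [Fintype X] [Fintype Y]
    {B : ι → Matrix Y X ℝ} (hB : ∀ i, ∀ ψ : X → ℝ, ∑ y, (B i).mulVec ψ y ^ 2 ≤ ∑ x, ψ x ^ 2)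
    {v : X → ℝ} (hv : ∑ x, v x ^ 2 = 1) (hfix : ∀ i, (B i).transpose.mulVec ((B i).mulVec v) = v)
    (n : ℕ) (ψ : (Fin n → X) → ℝ) (horth : ∑ c, ψ c * ∏ j, v (c j) = 0) :
    ∃ (J : Type u) (_ : Fintype J) (w : J → X → ℝ), (∀ j, ∑ x, w j x * v x = 0) ∧
      ∑ j, ∑ x, w j x ^ 2 = ∑ c, ψ c ^ 2 ∧
      ∀ i, ∑ r, (kronPow (B i) n).mulVec ψ r ^ 2 ≤ ∑ j, ∑ y, (B i).mulVec (w j) y ^ 2 := by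
  induction n with
  | zero =>
    refine ⟨PEmpty, inferInstance, fun j => j.elim, fun j => j.elim, ?_, fun i => ?_⟩
    · simp_all
    · simp_all [kronPow, Matrix.mulVec, dotProduct]
  | succ n ih =>
    set g : (Fin n → X) → ℝ := fun c => ∑ x, ψ (Fin.cons x c) * v x with hg
    set ψ' : (Fin n → X) → X → ℝ := fun c x => ψ (Fin.cons x c) - g c * v x with hψ'
    have hg0 : ∑ c, g c * ∏ j, v (c j) = 0 := by
      rw [← horth, sum_fin_succ_pi]
      refine Finset.sum_congr rfl fun c _ => ?_
      rw [hg, Finset.sum_mul]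
      refine Finset.sum_congr rfl fun x _ => ?_
      simp only [Fin.prod_univ_succ, Fin.cons_zero, Fin.cons_succ]
      ring
    obtain ⟨J, _, w, hw, hnorm, hval⟩ := ih g hg0
    refine ⟨J ⊕ (Fin n → X), inferInstance, Sum.elim w ψ', ?_, ?_, fun i => ?_⟩
    · rintro (j | c)
      · exact hw j
      · simp only [Sum.elim_inr, hψ', sub_mul, Finset.sum_sub_distrib, mul_assoc,
          ← Finset.mul_sum, ← sq, hv]
        simp [hg]
    · simp only [Fintype.sum_sum_type, Sum.elim_inl, Sum.elim_inr, hnorm]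
      rw [sum_fin_succ_pi, ← Finset.sum_add_distrib]
      exact Finset.sum_congr rfl fun c _ => (sum_sq_eq_add hv _).symm
    · have hcoef (r : Fin n → Y) :
          ∑ x, (kronPow (B i) n).mulVec (fun c => ψ (Fin.cons x c)) r * v x =
            (kronPow (B i) n).mulVec g r := by
        have := mulVec_sum_mul (kronPow (B i) n) v (fun x c => ψ (Fin.cons x c)) r
        simp only [mul_comm (v _)] at this
        exact this.symm
      have hrest (r : Fin n → Y) (x : X) :
          (kronPow (B i) n).mulVec (fun c => ψ (Fin.cons x c)) r -
            (kronPow (B i) n).mulVec g r * v x = (kronPow (B i) n).mulVec (fun c => ψ' c x) r := by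
        simp only [Matrix.mulVec, dotProduct, Finset.sum_mul, hψ', ← Finset.sum_sub_distrib]
        exact Finset.sum_congr rfl fun c _ => by ring
      simp only [Fintype.sum_sum_type, Sum.elim_inl, Sum.elim_inr]
      calc ∑ r, (kronPow (B i) (n + 1)).mulVec ψ r ^ 2
          = ∑ r, ((kronPow (B i) n).mulVec g r ^ 2 + ∑ y, (kronPow (B i) n).mulVec
              (fun c => (B i).mulVec (ψ' c) y) r ^ 2) := by
            rw [sum_fin_succ_pi]
            simp only [kronPow_succ_mulVec]
            refine Finset.sum_congr rfl fun r _ => ?_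
            rw [sum_mulVec_sq_eq_add hv (hfix i), hcoef]
            simp only [hrest]
            congr 1
            refine Finset.sum_congr rfl fun y _ => ?_
            rw [mulVec_mulVec_comm (B i) (kronPow (B i) n) (fun x c => ψ' c x)]
        _ ≤ _ := by
            rw [Finset.sum_add_distrib]
            refine add_le_add (hval i) ?_
            rw [Finset.sum_comm, Finset.sum_comm (s := (Finset.univ : Finset (Fin n → X)))]
            exact Finset.sum_le_sum fun y _ => sum_kronPow_mulVec_sq_le (hB i) n _

/-- If more than `card ι` weights are positive, some direction preserves the total `a`-mass and
shifts every `b i`-value by the same nonnegative amount while decreasing some weight. -/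
theorem exists_shift_direction {ι J : Type*} [Fintype ι] [Nonempty ι] {a : J → ℝ}
    (b : ι → J → ℝ) {s : Finset J} (ha : ∀ j ∈ s, 0 < a j) (hs : Fintype.card ι < s.card) :
    ∃ (d : J → ℝ) (t : ℝ), 0 ≤ t ∧ ∑ j ∈ s, d j * a j = 0 ∧
      (∀ i, ∑ j ∈ s, d j * b i j = t) ∧ ∃ j ∈ s, d j < 0 := by
  classical
  let L : ((s → ℝ) × ℝ) →ₗ[ℝ] ((ι → ℝ) × ℝ) :=
    { toFun := fun z => (fun i => ∑ j : s, z.1 j * b i j - z.2, ∑ j : s, z.1 j * a j)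
      map_add' := fun z z' => by
        ext <;> simp [add_mul, Finset.sum_add_distrib]
        ring
      map_smul' := fun r z => by
        ext <;> simp [mul_assoc, Finset.mul_sum, mul_sub] }
  have hker : LinearMap.ker L ≠ ⊥ := LinearMap.ker_ne_bot_of_finrank_lt (by simpa using hs)
  obtain ⟨z, hz, hz0⟩ := (Submodule.ne_bot_iff _).1 hker
  wlog ht : 0 ≤ z.2 generalizing z
  · exact this (-z) (neg_mem hz) (neg_ne_zero.2 hz0) (by simpa using (not_le.1 ht).le)
  have hL : L z = 0 := hz
  have h1 (i) : ∑ j : s, z.1 j * b i j = z.2 := sub_eq_zero.1 (congrFun (congrArg Prod.fst hL) i)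
  have h2 : ∑ j : s, z.1 j * a j = 0 := congrArg Prod.snd hL
  have hsum (f : J → ℝ) :
      ∑ j ∈ s, (if h : j ∈ s then z.1 ⟨j, h⟩ else 0) * f j = ∑ j : s, z.1 j * f j := by
    rw [← Finset.sum_coe_sort s]
    simp
  refine ⟨fun j => if h : j ∈ s then z.1 ⟨j, h⟩ else 0, z.2, ht, by rw [hsum, h2],
    fun i => by rw [hsum, h1], ?_⟩
  by_contra! hneg
  have hz1 : z.1 = 0 := by
    have hnn (j : s) : 0 ≤ z.1 j := by simpa using hneg j j.2
    have := (Finset.sum_eq_zero_iff_of_nonneg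
      fun (j : s) _ => mul_nonneg (hnn j) (ha j j.2).le).1 h2
    ext j
    exact (mul_eq_zero.1 (this j (Finset.mem_univ j))).resolve_right (ha j j.2).ne'
  have hz2 : z.2 = 0 := by rw [← h1 (Classical.arbitrary ι), hz1]; simp
  exact hz0 (Prod.ext hz1 hz2)

/-- A Carathéodory reduction: a positive combination is dominated by one of the same mass
supported on at most `card ι` points. -/
theorem exists_dominating_card_le {ι J : Type*} [Fintype ι] [Nonempty ι] {a : J → ℝ}
    (b : ι → J → ℝ) (s : Finset J) (ha : ∀ j ∈ s, 0 < a j) (p : J → ℝ) (hp : ∀ j ∈ s, 0 < p j) :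
    ∃ (t : Finset J) (q : J → ℝ), (∀ j ∈ t, 0 < q j) ∧ t.card ≤ Fintype.card ι ∧
      ∑ j ∈ t, q j * a j = ∑ j ∈ s, p j * a j ∧
      ∀ i, ∑ j ∈ s, p j * b i j ≤ ∑ j ∈ t, q j * b i j := by
  classical
  induction s using Finset.strongInduction generalizing p with
  | H s ih =>
    rcases le_or_gt s.card (Fintype.card ι) with hs | hs
    · exact ⟨s, p, hp, hs, rfl, fun _ => le_rfl⟩
    obtain ⟨d, t, ht, hda, hdb, j₁, hj₁, hdj₁⟩ := exists_shift_direction b ha hs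
    obtain ⟨j₀, hj₀, hmin⟩ := (s.filter fun j => d j < 0).exists_min_image (fun j => p j / -d j)
      ⟨j₁, by simp [hj₁, hdj₁]⟩
    obtain ⟨hj₀s, hdj₀⟩ := Finset.mem_filter.1 hj₀
    set θ := p j₀ / -d j₀
    have hθ : 0 < θ := div_pos (hp _ hj₀s) (neg_pos.2 hdj₀)
    set q : J → ℝ := fun j => p j + θ * d j with hq
    have hq0 : q j₀ = 0 := by
      have := hdj₀.ne
      simp only [hq, θ]
      field_simp
      ring
    have hqnn (j) (hj : j ∈ s) : 0 ≤ q j := by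
      rcases lt_or_ge (d j) 0 with h | h
      · have := (le_div_iff₀ (neg_pos.2 h)).1 (hmin j (by simp [hj, h]))
        simp only [hq]
        linarith
      · exact add_nonneg (hp j hj).le (mul_nonneg hθ.le h)
    have hsum (f : J → ℝ) : ∑ j ∈ s.filter (fun j => 0 < q j), q j * f j =
        ∑ j ∈ s, p j * f j + θ * ∑ j ∈ s, d j * f j := by
      rw [Finset.mul_sum, ← Finset.sum_add_distrib, Finset.sum_filter]
      refine Finset.sum_congr rfl fun j hj => ?_
      split_ifs with h
      · simp only [hq]; ring
      · have : q j = 0 := le_antisymm (not_lt.1 h) (hqnn j hj)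
        calc (0 : ℝ) = q j * f j := by rw [this, zero_mul]
          _ = _ := by simp only [hq]; ring
    obtain ⟨t', q', h1, h2, h3, h4⟩ := ih (s.filter fun j => 0 < q j)
      (Finset.filter_ssubset.2 ⟨j₀, hj₀s, by simp [hq0]⟩)
      (fun j hj => ha j (Finset.mem_filter.1 hj).1) q fun j hj => (Finset.mem_filter.1 hj).2
    refine ⟨t', q', h1, h2, ?_, fun i => ?_⟩
    · rw [h3, hsum, hda, mul_zero, add_zero]
    · refine le_trans ?_ (h4 i)
      rw [hsum, hdb]
      exact le_add_of_nonneg_right (mul_nonneg hθ.le ht)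

/-- The vector `∑ k, v ⊗ ⋯ ⊗ u k ⊗ ⋯ ⊗ v`, with `u k` at the `k`-th letter. -/
def singleExcitation {X : Type*} {K : ℕ} (v : X → ℝ) (u : Fin K → X → ℝ) (c : Fin K → X) : ℝ :=
  ∑ k, ∏ l, Function.update (fun _ => v) k (u k) l (c l)

theorem kronPow_mulVec_singleExcitation {X Y : Type*} [Fintype X] {K : ℕ} (B : Matrix Y X ℝ)
    (v : X → ℝ) (u : Fin K → X → ℝ) :
    (kronPow B K).mulVec (singleExcitation v u) =
      singleExcitation (B.mulVec v) fun k => B.mulVec (u k) := by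
  ext r
  simp only [Matrix.mulVec, dotProduct, kronPow, Matrix.of_apply, singleExcitation, Finset.mul_sum,
    ← Finset.prod_mul_distrib]
  rw [Finset.sum_comm]
  refine Finset.sum_congr rfl fun k _ => ?_
  rw [← Fintype.prod_sum fun l x => B (r l) x * Function.update (fun _ => v) k (u k) l x]
  refine Finset.prod_congr rfl fun l _ => ?_
  rcases eq_or_ne l k with rfl | h
  · simp [Matrix.mulVec, dotProduct]
  · simp [h, Matrix.mulVec, dotProduct]

theorem sum_singleExcitation_mul_prod {X : Type*} [Fintype X] {K : ℕ} {v : X → ℝ}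
    {u : Fin K → X → ℝ} (hu : ∀ k, ∑ x, u k x * v x = 0) :
    ∑ c, singleExcitation v u c * ∏ l, v (c l) = 0 := by
  simp only [singleExcitation, Finset.sum_mul, ← Finset.prod_mul_distrib]
  rw [Finset.sum_comm]
  refine Finset.sum_eq_zero fun k _ => ?_
  rw [← Fintype.prod_sum fun l x => Function.update (fun _ => v) k (u k) l x * v x]
  exact Finset.prod_eq_zero (Finset.mem_univ k) (by simpa using hu k)

theorem sum_singleExcitation_sq {X : Type*} [Fintype X] {K : ℕ} {v : X → ℝ}
    (hv : ∑ x, v x ^ 2 = 1) {u : Fin K → X → ℝ} (hu : ∀ k, ∑ x, u k x * v x = 0) :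
    ∑ c, singleExcitation v u c ^ 2 = ∑ k, ∑ x, u k x ^ 2 := by
  simp only [singleExcitation, sq, Finset.sum_mul_sum, ← Finset.prod_mul_distrib]
  rw [Finset.sum_comm]
  refine Finset.sum_congr rfl fun k _ => ?_
  rw [Finset.sum_comm, Finset.sum_eq_single k]
  · rw [← Fintype.prod_sum fun l x => Function.update (fun _ => v) k (u k) l x *
      Function.update (fun _ => v) k (u k) l x, Finset.prod_eq_single k]
    · simp
    · intro l _ hl
      simpa [hl, ← sq] using hv
    · simp
  · intro k' _ hk'
    rw [← Fintype.prod_sum fun l x => Function.update (fun _ => v) k (u k) l x *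
      Function.update (fun _ => v) k' (u k') l x]
    exact Finset.prod_eq_zero (Finset.mem_univ k) (by simpa [hk'.symm] using hu k)
  · simp

/-- Theorem 1, part (c), general K: K letters suffice for the single-direction
(binary equiprobable auxiliary) K-user broadcast problem. If `B₁,…,B_K` are
contractions fixing the unit vector `v₀`, then for every `n ≥ 1` and every unit
`ψ` on `n` letters orthogonal to `v₀^(n)`, there is a unit vector `φ` on `K`
letters orthogonal to `v₀^(K)` with
`min_i ‖B_i^(n)ψ‖² ≤ min_i ‖B_i^(K)φ‖²`; i.e. `sup_n λ_B^(n) = λ_B^(K)`. -/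
theorem broadcast_K_user_K_letters_suffice
    {X Y : Type*} [Fintype X] [Fintype Y] [Nonempty X] [Nonempty Y]
    (K : ℕ) (hK : 1 ≤ K) (B : Fin K → Matrix Y X ℝ)
    (hcontr : ∀ i, ∀ ψ : X → ℝ, ∑ y, ((B i).mulVec ψ y) ^ 2 ≤ ∑ x, ψ x ^ 2)
    (v₀ : X → ℝ) (hv₀ : ∑ x, v₀ x ^ 2 = 1)
    (hfix : ∀ i, (B i).transpose.mulVec ((B i).mulVec v₀) = v₀)
    (n : ℕ) (hn : 1 ≤ n)
    (ψ : (Fin n → X) → ℝ)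
    (hunit : ∑ c : Fin n → X, ψ c ^ 2 = 1)
    (horth : ∑ c : Fin n → X, ψ c * ∏ j, v₀ (c j) = 0) :
    ∃ φ : (Fin K → X) → ℝ,
      (∑ c : Fin K → X, φ c ^ 2 = 1) ∧
      (∑ c : Fin K → X, φ c * ∏ j, v₀ (c j) = 0) ∧
      (Finset.univ.inf' ⟨⟨0, hK⟩, Finset.mem_univ _⟩
          fun i : Fin K => ∑ r : Fin n → Y,
            ((Matrix.of fun (r : Fin n → Y) (c : Fin n → X) =>
                ∏ j, B i (r j) (c j)).mulVec ψ r) ^ 2)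
        ≤ Finset.univ.inf' ⟨⟨0, hK⟩, Finset.mem_univ _⟩
          fun i : Fin K => ∑ r : Fin K → Y,
            ((Matrix.of fun (r : Fin K → Y) (c : Fin K → X) =>
                ∏ j, B i (r j) (c j)).mulVec φ r) ^ 2 := by
  obtain ⟨J, _, w, hw, hnorm, hval⟩ := exists_one_letter_mixture hcontr hv₀ hfix n ψ horth
  have : Nonempty (Fin K) := ⟨⟨0, hK⟩⟩
  classical
  have hzero (j : J) (hj : ¬ 0 < ∑ x, w j x ^ 2) : ∑ x, w j x ^ 2 = 0 :=
    le_antisymm (not_lt.1 hj) (Finset.sum_nonneg fun x _ => sq_nonneg _)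
  obtain ⟨t, q, hq, hcard, hmass, hdom⟩ := exists_dominating_card_le
    (a := fun j => ∑ x, w j x ^ 2) (fun i j => ∑ y, (B i).mulVec (w j) y ^ 2)
    (Finset.univ.filter fun j => 0 < ∑ x, w j x ^ 2) (fun j hj => (Finset.mem_filter.1 hj).2)
    1 (fun _ _ => one_pos)
  obtain ⟨e⟩ : Nonempty (t ↪ Fin K) :=
    Function.Embedding.nonempty_of_card_le (by simpa using hcard)
  set u : Fin K → X → ℝ := Function.extend e (fun j => √(q j) • w j) 0 with hu
  have hu_e (j : t) : u (e j) = √(q j) • w j := e.injective.extend_apply _ _ j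
  have hu_ne (k) (hk : k ∉ Set.range e) : u k = 0 := Function.extend_apply' _ _ k hk
  have hu_orth (k) : ∑ x, u k x * v₀ x = 0 := by
    by_cases hk : k ∈ Set.range e
    · obtain ⟨j, rfl⟩ := hk
      simp [hu_e, mul_assoc, ← Finset.mul_sum, hw]
    · simp [hu_ne k hk]
  have hu_norm : ∑ k, ∑ x, u k x ^ 2 = ∑ j ∈ t, q j * ∑ x, w j x ^ 2 := by
    rw [← Finset.sum_coe_sort t]
    refine (Fintype.sum_of_injective e e.injective _ _ (fun k hk => by simp [hu_ne k hk])
      fun j => ?_).symm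
    simp [hu_e, mul_pow, Real.sq_sqrt (hq j j.2).le, Finset.mul_sum]
  have hu_val (i) : ∑ k, ∑ y, (B i).mulVec (u k) y ^ 2 =
      ∑ j ∈ t, q j * ∑ y, (B i).mulVec (w j) y ^ 2 := by
    rw [← Finset.sum_coe_sort t]
    refine (Fintype.sum_of_injective e e.injective _ _ (fun k hk => by simp [hu_ne k hk])
      fun j => ?_).symm
    simp [hu_e, Matrix.mulVec_smul, mul_pow, Real.sq_sqrt (hq j j.2).le, Finset.mul_sum]
  refine ⟨singleExcitation v₀ u, ?_, sum_singleExcitation_mul_prod hu_orth, ?_⟩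
  · rw [sum_singleExcitation_sq hv₀ hu_orth, hu_norm, hmass, Finset.sum_filter, ← hunit, ← hnorm]
    refine Finset.sum_congr rfl fun j _ => ?_
    split_ifs with h
    · simp
    · exact (hzero j h).symm
  · refine Finset.inf'_mono_fun fun i _ => ?_
    change ∑ r, (kronPow (B i) n).mulVec ψ r ^ 2 ≤
      ∑ r, (kronPow (B i) K).mulVec (singleExcitation v₀ u) r ^ 2
    have hBv : ∑ y, (B i).mulVec v₀ y ^ 2 = 1 := by
      simpa only [sq, sum_mulVec_mul_mulVec (hfix i)] using hv₀
    rw [kronPow_mulVec_singleExcitation, sum_singleExcitation_sq hBv fun k =>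
      (sum_mulVec_mul_mulVec (hfix i) (u k)).trans (hu_orth k), hu_val]
    refine ((hval i).trans ?_).trans (hdom i)
    rw [Finset.sum_filter]
    refine Finset.sum_le_sum fun j _ => ?_
    split_ifs with h
    · simp
    · exact (hcontr i (w j)).trans (hzero j h).le
end
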